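/- arXiv:2006.05917 — 4 statements merged into one kernel-verified Lean document; each statement's English description precedes it below -/
import Mathlib

section
/- For every integer d ≥ 1 and every real s with 0 ≤ s < d there exists a finite constant c = c(d, s) such that ∫∫∫ over {z ∈ ℝ^d : |z| ≤ 10} × {u ∈ ℝ^d : 1/2 ≤ |u| ≤ 1} × {v ∈ ℝ^d : 1/2 ≤ |v| ≤ 1} of (|z + v|^s |z − u|^s) / (|z|^s |z − u + v|^s) dz du dv is at most c (in particular the integrand is integrable on this region). -/
open MeasureTheory

/-- **Uniform integrability of the diagonal integrand.**
For every `d ≥ 1` and `0 ≤ s < d` there is a finite constant `c` such that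
`∫∫∫ (|z+v|^s |z−u|^s)/(|z|^s |z−u+v|^s) dz du dv ≤ c`, the integral being over
`|z| ≤ 10`, `1/2 ≤ |u| ≤ 1`, `1/2 ≤ |v| ≤ 1` (and the integrand being integrable there). -/
theorem stmt7 (d : ℕ) (hd : 1 ≤ d) (s : ℝ) (hs0 : 0 ≤ s) (hsd : s < d) :
    ∃ c : ℝ,
      IntegrableOn
        (fun p : EuclideanSpace ℝ (Fin d) × EuclideanSpace ℝ (Fin d) × EuclideanSpace ℝ (Fin d) =>
          ‖p.1 + p.2.2‖ ^ s * ‖p.1 - p.2.1‖ ^ s / (‖p.1‖ ^ s * ‖p.1 - p.2.1 + p.2.2‖ ^ s))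
        {p : EuclideanSpace ℝ (Fin d) × EuclideanSpace ℝ (Fin d) × EuclideanSpace ℝ (Fin d) |
          ‖p.1‖ ≤ 10 ∧ 1 / 2 ≤ ‖p.2.1‖ ∧ ‖p.2.1‖ ≤ 1 ∧ 1 / 2 ≤ ‖p.2.2‖ ∧ ‖p.2.2‖ ≤ 1}
        volume ∧
      (∫ p : EuclideanSpace ℝ (Fin d) × EuclideanSpace ℝ (Fin d) × EuclideanSpace ℝ (Fin d) in
          {p : EuclideanSpace ℝ (Fin d) × EuclideanSpace ℝ (Fin d) × EuclideanSpace ℝ (Fin d) |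
            ‖p.1‖ ≤ 10 ∧ 1 / 2 ≤ ‖p.2.1‖ ∧ ‖p.2.1‖ ≤ 1 ∧ 1 / 2 ≤ ‖p.2.2‖ ∧ ‖p.2.2‖ ≤ 1},
          ‖p.1 + p.2.2‖ ^ s * ‖p.1 - p.2.1‖ ^ s / (‖p.1‖ ^ s * ‖p.1 - p.2.1 + p.2.2‖ ^ s))
        ≤ c := by
  refine (fun h => ⟨_, h, le_rfl⟩) ?_
  set E := EuclideanSpace ℝ (Fin d) with hE
  have hfin : Module.finrank ℝ E = d := finrank_euclideanSpace_fin
  -- the one-variable majorants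
  let f : E → ℝ := (Metric.ball (0 : E) 13).indicator (fun x => ‖x‖ ^ (-s))
  let g : E → ℝ := (Metric.ball (0 : E) 2).indicator (fun _ => (1 : ℝ))
  have hf : Integrable f := by
    refine (integrable_indicator_iff measurableSet_ball).2 ?_
    refine integrableOn_ball_of_norm_le_rpow (C := 1) (α := s) (by rw [hfin]; exact hd)
      (by rw [hfin]; exact hsd) (Filter.Eventually.of_forall fun x => ?_) ?_
    · rw [one_mul, Real.norm_of_nonneg (by positivity)]
    · exact (measurable_norm.pow_const (-s)).aestronglyMeasurable
  have hg : Integrable g := by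
    refine (integrable_indicator_iff measurableSet_ball).2 ?_
    exact integrableOn_const (measure_ball_lt_top.ne)
  have hG : Integrable (fun q : E × E × E => f q.1 * (g q.2.1 * f q.2.2)) volume :=
    hf.mul_prod (hg.mul_prod hf)
  -- the shear
  have hT : MeasurePreserving (fun p : E × E × E => (p.1, p.2.1, p.1 - p.2.1 + p.2.2))
      volume volume := by
    refine MeasurePreserving.skew_product (μa := (volume : Measure E)) (μb := volume)
      (μc := (volume : Measure (E × E))) (μd := volume) (f := id)
      (g := fun (z : E) (q : E × E) => (q.1, z - q.1 + q.2)) (MeasurePreserving.id _)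
      (by unfold Function.uncurry; fun_prop) (Filter.Eventually.of_forall fun z => ?_)
    refine (MeasurePreserving.skew_product (μa := (volume : Measure E)) (μb := volume)
      (μc := (volume : Measure E)) (μd := volume) (f := id)
      (g := fun (u : E) (v : E) => z - u + v) (MeasurePreserving.id _)
      (by unfold Function.uncurry; fun_prop) (Filter.Eventually.of_forall fun u => ?_)).map_eq
    exact (measurePreserving_add_left volume (z - u)).map_eq
  have hH : Integrable (fun p : E × E × E =>
      (11 : ℝ) ^ s * 11 ^ s * (f p.1 * (g p.2.1 * f (p.1 - p.2.1 + p.2.2)))) volume :=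
    (hT.integrable_comp_of_integrable hG).const_mul _
  have hm : Measurable (fun p : E × E × E =>
      ‖p.1 + p.2.2‖ ^ s * ‖p.1 - p.2.1‖ ^ s / (‖p.1‖ ^ s * ‖p.1 - p.2.1 + p.2.2‖ ^ s)) := by
    fun_prop
  have hS : MeasurableSet {p : E × E × E |
      ‖p.1‖ ≤ 10 ∧ 1 / 2 ≤ ‖p.2.1‖ ∧ ‖p.2.1‖ ≤ 1 ∧ 1 / 2 ≤ ‖p.2.2‖ ∧ ‖p.2.2‖ ≤ 1} := by
    simp only [Set.setOf_and]
    refine MeasurableSet.inter ?_ (MeasurableSet.inter ?_ (MeasurableSet.inter ?_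
      (MeasurableSet.inter ?_ ?_))) <;>
      exact measurableSet_le (by fun_prop) (by fun_prop)
  refine Integrable.mono' hH.integrableOn hm.aestronglyMeasurable ?_
  refine (ae_restrict_iff' hS).2 (Filter.Eventually.of_forall ?_)
  rintro ⟨z, u, v⟩ ⟨hz, -, hu, -, hv⟩
  simp only at hz hu hv ⊢
  rw [Real.norm_of_nonneg (by positivity)]
  have h1 : ‖z + v‖ ≤ 11 := (norm_add_le _ _).trans (by linarith)
  have h2 : ‖z - u‖ ≤ 11 := (norm_sub_le _ _).trans (by linarith)
  have h3 : ‖z - u + v‖ < 13 := (norm_add_le _ _).trans_lt (by linarith)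
  have e1 : f z = ‖z‖ ^ (-s) :=
    Set.indicator_of_mem (mem_ball_zero_iff.2 (by linarith)) _
  have e2 : g u = 1 := Set.indicator_of_mem (mem_ball_zero_iff.2 (by linarith)) _
  have e3 : f (z - u + v) = ‖z - u + v‖ ^ (-s) :=
    Set.indicator_of_mem (mem_ball_zero_iff.2 h3) _
  rw [e1, e2, e3, one_mul, Real.rpow_neg (norm_nonneg _), Real.rpow_neg (norm_nonneg _),
    ← mul_inv, div_eq_mul_inv]
  gcongr
end

section
/- There exists a constant c > 0 (depending only on d, β and K) such that for all η ∈ (0,1), the integral of (|x − y + ηv|^{β²} |x − y − ηu|^{β²}) / (|x − y|^{β²} |x − y − ηu + ηv|^{β²}) over the set of (x, y, u, v) ∈ ℝ^d × ℝ^d × ℝ^d × ℝ^d with x ∈ K, y ∈ K, |x − y| ≤ 10η, 1/2 ≤ |u| ≤ 1 and 1/2 ≤ |v| ≤ 1 is at most c η^d. -/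
open MeasureTheory

noncomputable def gker (d : ℕ) (s : ℝ) (z : EuclideanSpace ℝ (Fin d)) : ENNReal :=
  (Metric.ball (0 : EuclideanSpace ℝ (Fin d)) 13).indicator
    (fun z => ENNReal.ofReal (‖z‖ ^ (-s))) z

lemma gker_meas (d : ℕ) (s : ℝ) : Measurable (gker d s) := by
  unfold gker
  exact (by fun_prop : Measurable fun z : EuclideanSpace ℝ (Fin d) =>
    ENNReal.ofReal (‖z‖ ^ (-s))).indicator measurableSet_ball

lemma gker_fin (d : ℕ) (hd : 2 ≤ d) (s : ℝ) (hs : s < d) :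
    ∫⁻ z, gker d s z < ⊤ := by
  unfold gker
  rw [lintegral_indicator measurableSet_ball]
  have h : IntegrableOn (fun z : EuclideanSpace ℝ (Fin d) => ‖z‖ ^ (-s)) (Metric.ball 0 13) := by
    refine integrableOn_ball_of_norm_le_rpow (α := s) (C := 1) ?_ ?_ ?_ ?_
    · simp; omega
    · simpa using hs
    · refine Filter.Eventually.of_forall fun x => ?_
      rw [one_mul, Real.norm_of_nonneg (by positivity)]
    · exact (by fun_prop : Measurable fun z : EuclideanSpace ℝ (Fin d) =>
        (‖z‖ ^ (-s))).aestronglyMeasurable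
  exact h.lintegral_lt_top

lemma gker_scale (d : ℕ) (s η : ℝ) (hη : 0 < η) (x : EuclideanSpace ℝ (Fin d)) :
    ∫⁻ y, gker d s (η⁻¹ • (x - y)) = ENNReal.ofReal (η ^ d) * ∫⁻ z, gker d s z := by
  rw [lintegral_sub_left_eq_self (fun y => gker d s (η⁻¹ • y)) x]
  rw [← lintegral_map (f := gker d s) (g := fun y => η⁻¹ • y) (gker_meas d s) (by fun_prop),
    Measure.map_addHaar_smul _ (inv_ne_zero hη.ne'), lintegral_smul_measure]
  simp [abs_of_pos hη]

lemma pointwise_eq {E : Type*} [NormedAddCommGroup E] [NormedSpace ℝ E] (s η : ℝ) (hη : 0 < η)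
    (w u v : E) :
    ‖w + η • v‖ ^ s * ‖w - η • u‖ ^ s / (‖w‖ ^ s * ‖w - η • u + η • v‖ ^ s) =
    (‖η⁻¹ • w + v‖ ^ s * ‖η⁻¹ • w - u‖ ^ s) *
      (‖η⁻¹ • w‖ ^ (-s) * ‖v - (u - η⁻¹ • w)‖ ^ (-s)) := by
  obtain ⟨z, rfl⟩ : ∃ z, w = η • z := ⟨η⁻¹ • w, by rw [smul_inv_smul₀ hη.ne']⟩
  rw [inv_smul_smul₀ hη.ne']
  have e : v - (u - z) = z - u + v := by abel
  rw [e, ← smul_add, ← smul_sub, ← smul_add]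
  simp only [norm_smul, Real.norm_of_nonneg hη.le]
  rw [Real.mul_rpow hη.le (by positivity), Real.mul_rpow hη.le (by positivity),
    Real.mul_rpow hη.le (by positivity), Real.mul_rpow hη.le (by positivity),
    Real.rpow_neg (by positivity), Real.rpow_neg (by positivity), ← mul_inv, ← div_eq_mul_inv]
  have : 0 < η ^ s := Real.rpow_pos_of_pos hη s
  rw [mul_mul_mul_comm, mul_mul_mul_comm (η ^ s) _ (η ^ s) _]
  exact mul_div_mul_left _ _ (by positivity)

lemma pointwise_le (d : ℕ) (s η : ℝ) (hs : 0 < s) (hη : 0 < η)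
    (w u v : EuclideanSpace ℝ (Fin d)) (hw : ‖w‖ ≤ 10 * η) (hu : ‖u‖ ≤ 1) (hv : ‖v‖ ≤ 1) :
    ENNReal.ofReal
      (‖w + η • v‖ ^ s * ‖w - η • u‖ ^ s / (‖w‖ ^ s * ‖w - η • u + η • v‖ ^ s)) ≤
    ENNReal.ofReal (11 ^ s * 11 ^ s) *
      (gker d s (η⁻¹ • w) * gker d s (v - (u - η⁻¹ • w))) := by
  rw [pointwise_eq s η hη]
  have hz : ‖η⁻¹ • w‖ ≤ 10 := by
    rw [norm_smul, norm_inv, Real.norm_of_nonneg hη.le, inv_mul_le_iff₀ hη]; linarith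
  set z := η⁻¹ • w
  have h1 : ‖z + v‖ ≤ 11 := (norm_add_le _ _).trans (by linarith)
  have h2 : ‖z - u‖ ≤ 11 := (norm_sub_le _ _).trans (by linarith)
  have h3 : ‖v - (u - z)‖ ≤ 12 := by
    have a := norm_sub_le v (u - z)
    have b := norm_sub_le u z
    linarith
  have m1 : z ∈ Metric.ball (0 : EuclideanSpace ℝ (Fin d)) 13 := by simp; linarith
  have m2 : v - (u - z) ∈ Metric.ball (0 : EuclideanSpace ℝ (Fin d)) 13 := by
    rw [mem_ball_zero_iff]; linarith
  unfold gker
  rw [Set.indicator_of_mem m1, Set.indicator_of_mem m2, ← ENNReal.ofReal_mul (by positivity),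
    ← ENNReal.ofReal_mul (by positivity)]
  apply ENNReal.ofReal_le_ofReal
  gcongr

lemma total_le (d : ℕ) (s η : ℝ) (hη : 0 < η) (A : ENNReal)
    (K B : Set (EuclideanSpace ℝ (Fin d))) (hK : MeasurableSet K) (hB : MeasurableSet B) :
    ∫⁻ p : (EuclideanSpace ℝ (Fin d) × EuclideanSpace ℝ (Fin d)) ×
            EuclideanSpace ℝ (Fin d) × EuclideanSpace ℝ (Fin d),
      K.indicator 1 p.1.1 * (B.indicator 1 p.2.1 * (A * (gker d s (η⁻¹ • (p.1.1 - p.1.2)) *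
        gker d s (p.2.2 - (p.2.1 - η⁻¹ • (p.1.1 - p.1.2)))))) ≤
    volume K * (volume B * (A * (ENNReal.ofReal (η ^ d) * (∫⁻ z, gker d s z) *
      ∫⁻ z, gker d s z))) := by
  have hg := gker_meas d s
  set C := ∫⁻ z, gker d s z with hC
  refine (lintegral_prod_le _).trans ?_
  have h1 : ∀ q : EuclideanSpace ℝ (Fin d) × EuclideanSpace ℝ (Fin d),
      ∫⁻ r : EuclideanSpace ℝ (Fin d) × EuclideanSpace ℝ (Fin d),
      K.indicator 1 q.1 * (B.indicator 1 r.1 * (A * (gker d s (η⁻¹ • (q.1 - q.2)) *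
        gker d s (r.2 - (r.1 - η⁻¹ • (q.1 - q.2)))))) ≤
      K.indicator 1 q.1 * (volume B * (A * (gker d s (η⁻¹ • (q.1 - q.2)) * C))) := by
    intro q
    refine (lintegral_prod_le _).trans ?_
    have h2 : ∀ u, ∫⁻ v, K.indicator 1 q.1 * (B.indicator 1 u *
        (A * (gker d s (η⁻¹ • (q.1 - q.2)) * gker d s (v - (u - η⁻¹ • (q.1 - q.2)))))) =
        B.indicator 1 u *
          (K.indicator 1 q.1 * (A * (gker d s (η⁻¹ • (q.1 - q.2)) * C))) := by
      intro u
      rw [lintegral_const_mul _ (by fun_prop), lintegral_const_mul _ (by fun_prop),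
        lintegral_const_mul _ (by fun_prop), lintegral_const_mul _ (by fun_prop),
        lintegral_sub_right_eq_self (gker d s), mul_left_comm]
    simp only [h2]
    rw [lintegral_mul_const _ (measurable_one.indicator hB), lintegral_indicator_one hB,
      mul_left_comm]
  refine (lintegral_mono h1).trans ?_
  refine (lintegral_prod_le _).trans ?_
  have h3 : ∀ x, ∫⁻ y, K.indicator 1 x *
      (volume B * (A * (gker d s (η⁻¹ • (x - y)) * C))) =
      K.indicator 1 x * (volume B * (A * (ENNReal.ofReal (η ^ d) * C * C))) := by
    intro x
    rw [lintegral_const_mul _ (by fun_prop), lintegral_const_mul _ (by fun_prop),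
        lintegral_const_mul _ (by fun_prop), lintegral_mul_const _ (by fun_prop),
        gker_scale d s η hη]
  simp only [h3]
  rw [lintegral_mul_const _ (measurable_one.indicator hK), lintegral_indicator_one hK]

/-- **The diagonal part `|x−y| ≤ 10η` contributes at most `c η^d`.**
Let `d ≥ 2`, `β ∈ (0, √d)` and `K ⊆ ℝ^d` compact. There is `c > 0` such that for all
`η ∈ (0,1)`, the integral of `(|x−y+ηv|^{β²} |x−y−ηu|^{β²})/(|x−y|^{β²} |x−y−ηu+ηv|^{β²})`
over `x, y ∈ K`, `|x−y| ≤ 10η`, `1/2 ≤ |u| ≤ 1`, `1/2 ≤ |v| ≤ 1` is at most `c η^d`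
(and the integrand is integrable on that region). -/
theorem stmt8 (d : ℕ) (hd : 2 ≤ d) (β : ℝ) (hβ : 0 < β) (hβd : β ^ 2 < d)
    (K : Set (EuclideanSpace ℝ (Fin d))) (hK : IsCompact K) :
    ∃ c > 0, ∀ η : ℝ, η ∈ Set.Ioo (0:ℝ) 1 →
      IntegrableOn
        (fun p : (EuclideanSpace ℝ (Fin d) × EuclideanSpace ℝ (Fin d)) ×
            EuclideanSpace ℝ (Fin d) × EuclideanSpace ℝ (Fin d) =>
          ‖p.1.1 - p.1.2 + η • p.2.2‖ ^ (β ^ 2) * ‖p.1.1 - p.1.2 - η • p.2.1‖ ^ (β ^ 2) /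
            (‖p.1.1 - p.1.2‖ ^ (β ^ 2) * ‖p.1.1 - p.1.2 - η • p.2.1 + η • p.2.2‖ ^ (β ^ 2)))
        {p : (EuclideanSpace ℝ (Fin d) × EuclideanSpace ℝ (Fin d)) ×
            EuclideanSpace ℝ (Fin d) × EuclideanSpace ℝ (Fin d) |
          p.1.1 ∈ K ∧ p.1.2 ∈ K ∧ dist p.1.1 p.1.2 ≤ 10 * η ∧
          1 / 2 ≤ ‖p.2.1‖ ∧ ‖p.2.1‖ ≤ 1 ∧ 1 / 2 ≤ ‖p.2.2‖ ∧ ‖p.2.2‖ ≤ 1}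
        volume ∧
      (∫ p : (EuclideanSpace ℝ (Fin d) × EuclideanSpace ℝ (Fin d)) ×
            EuclideanSpace ℝ (Fin d) × EuclideanSpace ℝ (Fin d) in
          {p : (EuclideanSpace ℝ (Fin d) × EuclideanSpace ℝ (Fin d)) ×
              EuclideanSpace ℝ (Fin d) × EuclideanSpace ℝ (Fin d) |
            p.1.1 ∈ K ∧ p.1.2 ∈ K ∧ dist p.1.1 p.1.2 ≤ 10 * η ∧
            1 / 2 ≤ ‖p.2.1‖ ∧ ‖p.2.1‖ ≤ 1 ∧ 1 / 2 ≤ ‖p.2.2‖ ∧ ‖p.2.2‖ ≤ 1},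
          ‖p.1.1 - p.1.2 + η • p.2.2‖ ^ (β ^ 2) * ‖p.1.1 - p.1.2 - η • p.2.1‖ ^ (β ^ 2) /
            (‖p.1.1 - p.1.2‖ ^ (β ^ 2) * ‖p.1.1 - p.1.2 - η • p.2.1 + η • p.2.2‖ ^ (β ^ 2)))
        ≤ c * η ^ d := by

  set B := Metric.closedBall (0 : EuclideanSpace ℝ (Fin d)) 1
  have hs : 0 < β ^ 2 := by positivity
  set s := β ^ 2
  have hC := gker_fin d hd s hβd
  set C := ∫⁻ z, gker d s z with hCdef
  set T : ENNReal := volume K * (volume B * (ENNReal.ofReal (11 ^ s * 11 ^ s) * (C * C))) with hT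
  have hTtop : T < ⊤ := ENNReal.mul_lt_top hK.measure_lt_top (ENNReal.mul_lt_top
    measure_closedBall_lt_top (ENNReal.mul_lt_top ENNReal.ofReal_lt_top (ENNReal.mul_lt_top hC hC)))
  refine ⟨T.toReal + 1, by positivity, ?_⟩
  rintro η ⟨hη, -⟩
  set F := fun p : (EuclideanSpace ℝ (Fin d) × EuclideanSpace ℝ (Fin d)) ×
            EuclideanSpace ℝ (Fin d) × EuclideanSpace ℝ (Fin d) =>
          ‖p.1.1 - p.1.2 + η • p.2.2‖ ^ s * ‖p.1.1 - p.1.2 - η • p.2.1‖ ^ s /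
            (‖p.1.1 - p.1.2‖ ^ s * ‖p.1.1 - p.1.2 - η • p.2.1 + η • p.2.2‖ ^ s) with hF
  set S := {p : (EuclideanSpace ℝ (Fin d) × EuclideanSpace ℝ (Fin d)) ×
            EuclideanSpace ℝ (Fin d) × EuclideanSpace ℝ (Fin d) |
          p.1.1 ∈ K ∧ p.1.2 ∈ K ∧ dist p.1.1 p.1.2 ≤ 10 * η ∧
          1 / 2 ≤ ‖p.2.1‖ ∧ ‖p.2.1‖ ≤ 1 ∧ 1 / 2 ≤ ‖p.2.2‖ ∧ ‖p.2.2‖ ≤ 1} with hSdef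
  have hKm := hK.measurableSet
  have hSm : MeasurableSet S := by
    simp only [hSdef, Set.setOf_and]
    refine (measurableSet_preimage (by fun_prop) hKm).inter
      ((measurableSet_preimage (by fun_prop) hKm).inter ?_)
    refine MeasurableSet.inter ?_ (MeasurableSet.inter ?_ (MeasurableSet.inter ?_
      (MeasurableSet.inter ?_ ?_))) <;> exact measurableSet_le (by fun_prop) (by fun_prop)
  have hFm : Measurable F := by
    rw [hF]; fun_prop
  have hF0 : ∀ p, 0 ≤ F p := fun p => by rw [hF]; positivity
  have key : ∫⁻ p in S, ENNReal.ofReal (F p) ≤ T * ENNReal.ofReal (η ^ d) := by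
    rw [← lintegral_indicator hSm]
    refine (lintegral_mono ?_).trans ((total_le d s η hη (ENNReal.ofReal (11 ^ s * 11 ^ s)) K B hKm
      Metric.isClosed_closedBall.measurableSet).trans (le_of_eq ?_))
    · intro p
      by_cases hp : p ∈ S
      · have hB : p.2.1 ∈ B := by simpa [B] using hp.2.2.2.2.1
        rw [Set.indicator_of_mem hp]
        simp only [Set.indicator_of_mem hp.1, Set.indicator_of_mem hB, Pi.one_apply, one_mul]
        exact pointwise_le d s η hs hη _ _ _ (by simpa [dist_eq_norm] using hp.2.2.1)
          hp.2.2.2.2.1 hp.2.2.2.2.2.2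
      · rw [Set.indicator_of_notMem hp]; exact zero_le
    · rw [hT]; ring
  have hfin : T * ENNReal.ofReal (η ^ d) < ⊤ := ENNReal.mul_lt_top hTtop ENNReal.ofReal_lt_top
  constructor
  · refine ⟨hFm.aestronglyMeasurable, ?_⟩
    rw [hasFiniteIntegral_iff_ofReal (Filter.Eventually.of_forall hF0)]
    exact key.trans_lt hfin
  · rw [integral_eq_lintegral_of_nonneg_ae (Filter.Eventually.of_forall hF0)
      hFm.aestronglyMeasurable]
    refine (ENNReal.toReal_mono hfin.ne key).trans ?_
    rw [ENNReal.toReal_mul, ENNReal.toReal_ofReal (by positivity)]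
    gcongr
    linarith
end

section
/- There exists a constant c > 0 (depending only on β and K) such that for all η₁, η₂ with 0 < η₁ < η₂/100 and η₂ < 1, and all u, v ∈ ℝ² with 1/2 ≤ |u| ≤ 1 and 1/2 ≤ |v| ≤ 1, one has η₁⁻¹ η₂⁻¹ ∫∫ over {(x,y) ∈ K × K : |x − y| ≤ 10η₁} of (|x − y − η₁u|^{β²} |x − y + η₂v|^{β²}) / (|x − y|^{β²} |x − y − η₁u + η₂v|^{β²}) dx dy ≤ c η₁ / η₂. -/
open MeasureTheory

/-- The singular kernel `‖w‖ ^ (-b)` cut off at radius `11` is integrable in the plane. -/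
lemma H_integrable (b : ℝ) (hb2 : b < 2) :
    Integrable ((Metric.ball (0 : EuclideanSpace ℝ (Fin 2)) 11).indicator
      (fun w => (33 : ℝ) ^ b * ‖w‖ ^ (-b))) volume := by
  rw [integrable_indicator_iff Metric.isOpen_ball.measurableSet]
  apply Integrable.const_mul
  change IntegrableOn (fun w : EuclideanSpace ℝ (Fin 2) => ‖w‖ ^ (-b)) (Metric.ball 0 11) volume
  rw [integrableOn_fun_norm_addHaar volume (f := fun r : ℝ => r ^ (-b))]
  have h : IntegrableOn (fun y : ℝ => y ^ (1 - b)) (Set.Ioo 0 11) volume := by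
    rw [intervalIntegral.integrableOn_Ioo_rpow_iff (by norm_num)]
    linarith
  refine h.congr_fun ?_ measurableSet_Ioo
  intro y hy
  simp only [finrank_euclideanSpace, Fintype.card_fin, smul_eq_mul]
  rw [sub_eq_add_neg, Real.rpow_add hy.1]
  simp

/-- Pointwise estimate of the integrand. -/
lemma pointwise_bound (b : ℝ) (hb : 0 < b) (η₁ η₂ : ℝ) (h0 : 0 < η₁) (h1 : η₁ < η₂ / 100)
    (u v z : EuclideanSpace ℝ (Fin 2)) (hu : ‖u‖ ≤ 1) (hv' : 1 / 2 ≤ ‖v‖) (hv : ‖v‖ ≤ 1)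
    (hz : ‖z‖ ≤ 10 * η₁) :
    ‖z - η₁ • u‖ ^ b * ‖z + η₂ • v‖ ^ b / (‖z‖ ^ b * ‖z - η₁ • u + η₂ • v‖ ^ b)
      ≤ (33 : ℝ) ^ b * ‖η₁⁻¹ • z‖ ^ (-b) := by
  have h2 : 0 < η₂ := by linarith
  have e1 : ‖η₁ • u‖ ≤ η₁ := by
    rw [norm_smul, Real.norm_of_nonneg h0.le]; nlinarith
  have e2 : ‖η₂ • v‖ ≤ η₂ := by
    rw [norm_smul, Real.norm_of_nonneg h2.le]; nlinarith
  have e3 : η₂ / 2 ≤ ‖η₂ • v‖ := by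
    rw [norm_smul, Real.norm_of_nonneg h2.le]; nlinarith
  have a1 : ‖z - η₁ • u‖ ≤ 11 * η₁ := by
    linarith [norm_sub_le z (η₁ • u)]
  have a2 : ‖z + η₂ • v‖ ≤ 11 / 10 * η₂ := by
    linarith [norm_add_le z (η₂ • v)]
  have a3 : 39 / 100 * η₂ ≤ ‖z - η₁ • u + η₂ • v‖ := by
    have := norm_sub_le (z - η₁ • u + η₂ • v) (z - η₁ • u)
    rw [add_sub_cancel_left] at this
    linarith
  have a4 : ‖z + η₂ • v‖ / ‖z - η₁ • u + η₂ • v‖ ≤ 3 := by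
    rw [div_le_iff₀ (by linarith)]; linarith
  have a5 : ‖z - η₁ • u‖ * (‖z + η₂ • v‖ / ‖z - η₁ • u + η₂ • v‖) ≤ 33 * η₁ := by
    calc _ ≤ (11 * η₁) * 3 := by gcongr
      _ = _ := by ring
  have a6 : ‖η₁⁻¹ • z‖ = ‖z‖ / η₁ := by
    rw [norm_smul, norm_inv, Real.norm_of_nonneg h0.le]; field_simp
  rw [a6, Real.rpow_neg (by positivity), ← Real.inv_rpow (by positivity),
    ← Real.mul_rpow (by positivity) (by positivity), ← Real.mul_rpow (by positivity) (by positivity),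
    ← Real.mul_rpow (by positivity) (by positivity), ← Real.div_rpow (by positivity) (by positivity)]
  apply Real.rpow_le_rpow (by positivity) _ hb.le
  calc _ = ‖z - η₁ • u‖ * (‖z + η₂ • v‖ / ‖z - η₁ • u + η₂ • v‖) / ‖z‖ := by
        rw [mul_comm ‖z‖, ← div_div, mul_div_assoc]
    _ ≤ 33 * η₁ / ‖z‖ := by gcongr
    _ = _ := by rw [inv_div]; ring

/-- **Two-scale diagonal bound in dimension two.**
Let `β ∈ (0, √2)` and `K ⊆ ℝ²` compact. There is `c > 0` such that for all
`0 < η₁ < η₂/100` with `η₂ < 1` and all `u, v ∈ ℝ²` with `1/2 ≤ |u|, |v| ≤ 1`,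
`η₁⁻¹ η₂⁻¹ ∫∫_{x,y ∈ K, |x−y| ≤ 10η₁}
  (|x−y−η₁u|^{β²} |x−y+η₂v|^{β²})/(|x−y|^{β²} |x−y−η₁u+η₂v|^{β²}) dx dy ≤ c η₁/η₂`
(and the integrand is integrable on that region). -/
theorem stmt9 (β : ℝ) (hβ : 0 < β) (hβ2 : β ^ 2 < 2)
    (K : Set (EuclideanSpace ℝ (Fin 2))) (hK : IsCompact K) :
    ∃ c > 0, ∀ η₁ η₂ : ℝ, 0 < η₁ → η₁ < η₂ / 100 → η₂ < 1 →
      ∀ u v : EuclideanSpace ℝ (Fin 2), 1 / 2 ≤ ‖u‖ → ‖u‖ ≤ 1 → 1 / 2 ≤ ‖v‖ → ‖v‖ ≤ 1 →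
      IntegrableOn
        (fun p : EuclideanSpace ℝ (Fin 2) × EuclideanSpace ℝ (Fin 2) =>
          ‖p.1 - p.2 - η₁ • u‖ ^ (β ^ 2) * ‖p.1 - p.2 + η₂ • v‖ ^ (β ^ 2) /
            (‖p.1 - p.2‖ ^ (β ^ 2) * ‖p.1 - p.2 - η₁ • u + η₂ • v‖ ^ (β ^ 2)))
        {p : EuclideanSpace ℝ (Fin 2) × EuclideanSpace ℝ (Fin 2) |
          p.1 ∈ K ∧ p.2 ∈ K ∧ dist p.1 p.2 ≤ 10 * η₁} volume ∧
      η₁⁻¹ * η₂⁻¹ *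
        (∫ p : EuclideanSpace ℝ (Fin 2) × EuclideanSpace ℝ (Fin 2) in
            {p : EuclideanSpace ℝ (Fin 2) × EuclideanSpace ℝ (Fin 2) |
              p.1 ∈ K ∧ p.2 ∈ K ∧ dist p.1 p.2 ≤ 10 * η₁},
            ‖p.1 - p.2 - η₁ • u‖ ^ (β ^ 2) * ‖p.1 - p.2 + η₂ • v‖ ^ (β ^ 2) /
              (‖p.1 - p.2‖ ^ (β ^ 2) * ‖p.1 - p.2 - η₁ • u + η₂ • v‖ ^ (β ^ 2)))
        ≤ c * η₁ / η₂ := by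
  classical
  set b := β ^ 2 with hbdef
  have hb : 0 < b := by positivity
  set H : EuclideanSpace ℝ (Fin 2) → ℝ := (Metric.ball (0 : EuclideanSpace ℝ (Fin 2)) 11).indicator
      (fun w => (33 : ℝ) ^ b * ‖w‖ ^ (-b)) with hH
  have hHi : Integrable H volume := H_integrable b hβ2
  have hH0 : ∀ w, 0 ≤ H w := fun w => Set.indicator_nonneg (fun _ _ => by positivity) w
  set f : EuclideanSpace ℝ (Fin 2) → ℝ := K.indicator (fun _ => 1) with hf
  have hfi : Integrable f volume := by
    rw [hf, integrable_indicator_iff hK.measurableSet]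
    exact integrableOn_const hK.measure_lt_top.ne
  have hf0 : ∀ w, 0 ≤ f w := fun w => Set.indicator_nonneg (fun _ _ => by positivity) w
  have hA : 0 ≤ ∫ y, f y := integral_nonneg hf0
  have hB : 0 ≤ ∫ y, H y := integral_nonneg hH0
  refine ⟨(∫ y, f y) * (∫ y, H y) + 1, by positivity, ?_⟩
  intro η₁ η₂ h0 h1 h2 u v hu' hu hv' hv
  have hη2 : 0 < η₂ := by linarith
  set S : Set (EuclideanSpace ℝ (Fin 2) × EuclideanSpace ℝ (Fin 2)) :=
    {p | p.1 ∈ K ∧ p.2 ∈ K ∧ dist p.1 p.2 ≤ 10 * η₁} with hS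
  have hSm : MeasurableSet S := by
    have : IsClosed S := by
      have := hK.isClosed
      refine (this.preimage continuous_fst).inter ((this.preimage continuous_snd).inter ?_)
      exact isClosed_le (continuous_fst.dist continuous_snd) continuous_const
    exact this.measurableSet
  have hGi : Integrable (fun z => H (η₁⁻¹ • z)) volume :=
    hHi.comp_smul (inv_ne_zero h0.ne')
  have hGint : ∫ z, H (η₁⁻¹ • z) = η₁ ^ 2 * ∫ z, H z := by
    rw [Measure.integral_comp_inv_smul_of_nonneg volume H h0.le]
    simp
  have hgi : Integrable (fun p : EuclideanSpace ℝ (Fin 2) × EuclideanSpace ℝ (Fin 2) =>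
      f p.2 * H (η₁⁻¹ • (p.1 - p.2))) volume :=
    hfi.convolution_integrand (ContinuousLinearMap.mul ℝ ℝ) hGi
  have hgint : ∫ p : EuclideanSpace ℝ (Fin 2) × EuclideanSpace ℝ (Fin 2),
      f p.2 * H (η₁⁻¹ • (p.1 - p.2)) = (∫ y, f y) * (η₁ ^ 2 * ∫ z, H z) := by
    have e := integral_convolution (ContinuousLinearMap.mul ℝ ℝ) hfi hGi
    have e2 := integral_prod _ hgi
    rw [← hGint]
    exact e2.trans e
  have hpt : ∀ p ∈ S, ‖p.1 - p.2 - η₁ • u‖ ^ b * ‖p.1 - p.2 + η₂ • v‖ ^ b /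
            (‖p.1 - p.2‖ ^ b * ‖p.1 - p.2 - η₁ • u + η₂ • v‖ ^ b)
            ≤ f p.2 * H (η₁⁻¹ • (p.1 - p.2)) := by
    rintro p ⟨_, hp2, hp⟩
    rw [dist_eq_norm] at hp
    have hb1 : η₁⁻¹ • (p.1 - p.2) ∈ Metric.ball (0 : EuclideanSpace ℝ (Fin 2)) 11 := by
      rw [mem_ball_zero_iff, norm_smul, norm_inv, Real.norm_of_nonneg h0.le, inv_mul_lt_iff₀ h0]
      linarith
    rw [hf, hH, Set.indicator_of_mem hp2, Set.indicator_of_mem hb1, one_mul]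
    exact pointwise_bound b hb η₁ η₂ h0 h1 u v _ hu hv' hv hp
  have hFi : IntegrableOn
        (fun p : EuclideanSpace ℝ (Fin 2) × EuclideanSpace ℝ (Fin 2) =>
          ‖p.1 - p.2 - η₁ • u‖ ^ b * ‖p.1 - p.2 + η₂ • v‖ ^ b /
            (‖p.1 - p.2‖ ^ b * ‖p.1 - p.2 - η₁ • u + η₂ • v‖ ^ b)) S volume := by
    refine Integrable.mono' hgi.integrableOn ?_ ?_
    · exact Measurable.aestronglyMeasurable (by fun_prop)
    · refine (ae_restrict_iff' hSm).2 (Filter.Eventually.of_forall fun p hp => ?_)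
      rw [Real.norm_of_nonneg (by positivity)]
      exact hpt p hp
  refine ⟨hFi, ?_⟩
  have hle : (∫ p in S, ‖p.1 - p.2 - η₁ • u‖ ^ b * ‖p.1 - p.2 + η₂ • v‖ ^ b /
            (‖p.1 - p.2‖ ^ b * ‖p.1 - p.2 - η₁ • u + η₂ • v‖ ^ b))
            ≤ (∫ y, f y) * (η₁ ^ 2 * ∫ z, H z) := by
    rw [← hgint]
    refine (setIntegral_mono_on hFi hgi.integrableOn hSm hpt).trans ?_
    exact setIntegral_le_integral hgi
      (Filter.Eventually.of_forall fun p => mul_nonneg (hf0 _) (hH0 _))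
  calc _ ≤ η₁⁻¹ * η₂⁻¹ * ((∫ y, f y) * (η₁ ^ 2 * ∫ z, H z)) := by gcongr
    _ = ((∫ y, f y) * (∫ z, H z)) * η₁ / η₂ := by field_simp
    _ ≤ _ := by gcongr; linarith
end

section
/- For all f, h smooth compactly supported functions on U and for η ∈ (0, dist(supp f, ℝ^d ∖ U)/2), the triple integral J(η) := ∫∫∫ f(x) h(y) ∂₁C(u, y) φ_η(x − u) du dy dx (over u, y, x ∈ ℝ^d, where the integrand is set to 0 outside its domain of definition) is well defined, and J(η) converges, as η → 0⁺, to ∫∫ f(x) h(y) ∂₁C(x, y) dy dx. -/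
open MeasureTheory Filter
open scoped ContDiff Topology Classical

theorem aux_riesz (d : ℕ) (hd : 2 ≤ d) (R : ℝ) :
    Integrable ((Metric.ball (0 : EuclideanSpace ℝ (Fin d)) R).indicator (fun w => ‖w‖⁻¹)) := by
  have : Nonempty (Fin d) := Fin.pos_iff_nonempty.1 (lt_of_lt_of_le Nat.zero_lt_two hd)
  rw [integrable_indicator_iff Metric.isOpen_ball.measurableSet]
  have := (integrableOn_fun_norm_addHaar (volume : Measure (EuclideanSpace ℝ (Fin d)))
    (f := fun r : ℝ => r⁻¹) (r := R)).2 ?_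
  · exact this
  · have hc : IntegrableOn (fun y : ℝ => y ^ (d - 2)) (Set.Ioo 0 R) :=
      ((continuous_pow (d-2)).integrableOn_Icc (a := 0) (b := R)).mono_set Set.Ioo_subset_Icc_self
    refine hc.congr_fun ?_ measurableSet_Ioo
    intro y hy
    have : Module.finrank ℝ (EuclideanSpace ℝ (Fin d)) - 1 = (d - 2) + 1 := by simp; omega
    simp only [this, smul_eq_mul, pow_succ]
    have := hy.1.ne'
    field_simp

theorem aux_kernel (d : ℕ) (hd : 2 ≤ d) (i : Fin d)
    (U : Set (EuclideanSpace ℝ (Fin d))) (hU : IsOpen U)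
    (g : EuclideanSpace ℝ (Fin d) → EuclideanSpace ℝ (Fin d) → ℝ)
    (hg : ContDiffOn ℝ 2
      (fun p : EuclideanSpace ℝ (Fin d) × EuclideanSpace ℝ (Fin d) => g p.1 p.2) (U ×ˢ U))
    (C₁ : EuclideanSpace ℝ (Fin d) → EuclideanSpace ℝ (Fin d) → ℝ)
    (hC₁ : ∀ x y, C₁ x y = if x ∈ U ∧ y ∈ U ∧ x ≠ y then
      -((x i - y i) / dist x y ^ 2)
        + fderiv ℝ (fun x' => g x' y) x (EuclideanSpace.single i 1) else 0)
    (h : EuclideanSpace ℝ (Fin d) → ℝ)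
    (hh : Continuous h) (hhc : HasCompactSupport h) (hhU : tsupport h ⊆ U)
    (K : Set (EuclideanSpace ℝ (Fin d))) (hK : IsCompact K) (hKU : K ⊆ U) :
    Integrable (fun q : EuclideanSpace ℝ (Fin d) × EuclideanSpace ℝ (Fin d) =>
      K.indicator (fun _ => (1:ℝ)) q.1 * h q.2 * C₁ q.1 q.2)
      ((volume : Measure (EuclideanSpace ℝ (Fin d))).prod volume) := by
  set e : EuclideanSpace ℝ (Fin d) := EuclideanSpace.single i 1 with he
  set G : EuclideanSpace ℝ (Fin d) × EuclideanSpace ℝ (Fin d) → ℝ := fun q =>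
    fderiv ℝ (fun p : EuclideanSpace ℝ (Fin d) × EuclideanSpace ℝ (Fin d) => g p.1 p.2) q (e, 0)
    with hG
  have hUU : IsOpen (U ×ˢ U) := hU.prod hU
  have hGc : ContinuousOn G (U ×ˢ U) :=
    (hg.continuousOn_fderiv_of_isOpen hUU (by norm_num)).clm_apply continuousOn_const
  have hGe : ∀ x ∈ U, ∀ y ∈ U, fderiv ℝ (fun x' => g x' y) x e = G (x, y) := by
    intro x hx y hy
    have h1 : HasFDerivAt (fun p : EuclideanSpace ℝ (Fin d) × EuclideanSpace ℝ (Fin d) =>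
        g p.1 p.2) _ (x, y) :=
      ((hg.differentiableOn (by norm_num)).differentiableAt
        (hUU.mem_nhds ⟨hx, hy⟩)).hasFDerivAt
    have h2 : HasFDerivAt (fun x' : EuclideanSpace ℝ (Fin d) => (x', y)) _ x :=
      hasFDerivAt_prodMk_left (𝕜 := ℝ) x y
    have h3 := (HasFDerivAt.comp x h1 h2).fderiv
    have h4 : ((fun p : EuclideanSpace ℝ (Fin d) × EuclideanSpace ℝ (Fin d) =>
        g p.1 p.2) ∘ fun x' : EuclideanSpace ℝ (Fin d) => (x', y)) = fun x' => g x' y := rfl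
    rw [h4] at h3
    rw [h3]
    simp [hG]
  -- measurability
  set V : Set (EuclideanSpace ℝ (Fin d) × EuclideanSpace ℝ (Fin d)) :=
    {q | q.1 ∈ U ∧ q.2 ∈ U ∧ q.1 ≠ q.2} with hV
  have hVo : IsOpen V :=
    (hU.preimage continuous_fst).inter ((hU.preimage continuous_snd).inter
      (isOpen_ne_fun continuous_fst continuous_snd))
  set F : EuclideanSpace ℝ (Fin d) × EuclideanSpace ℝ (Fin d) → ℝ := fun q =>
    -((q.1 i - q.2 i) / dist q.1 q.2 ^ 2) + G q with hF
  have hFc : ContinuousOn F V := by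
    refine ContinuousOn.add (ContinuousOn.neg (ContinuousOn.div ?_ ?_ ?_))
      (hGc.mono fun q hq => ⟨hq.1, hq.2.1⟩)
    · exact Continuous.continuousOn (by fun_prop)
    · exact Continuous.continuousOn (by fun_prop)
    · intro q hq
      exact pow_ne_zero _ (dist_ne_zero.2 hq.2.2)
  have hCF : (fun q : EuclideanSpace ℝ (Fin d) × EuclideanSpace ℝ (Fin d) => C₁ q.1 q.2)
      = V.indicator F := by
    funext q
    rw [hC₁]
    by_cases hq : q ∈ V
    · rw [Set.indicator_of_mem hq, if_pos (show q.1 ∈ U ∧ q.2 ∈ U ∧ q.1 ≠ q.2 from hq), hGe _ hq.1 _ hq.2.1]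
    · rw [Set.indicator_of_notMem hq, if_neg (show ¬ (q.1 ∈ U ∧ q.2 ∈ U ∧ q.1 ≠ q.2) from hq)]
  have hCm : AEStronglyMeasurable
      (fun q : EuclideanSpace ℝ (Fin d) × EuclideanSpace ℝ (Fin d) => C₁ q.1 q.2)
      ((volume : Measure (EuclideanSpace ℝ (Fin d))).prod volume) := by
    rw [hCF, aestronglyMeasurable_indicator_iff hVo.measurableSet]
    exact hFc.aestronglyMeasurable hVo.measurableSet
  have hKm : Measurable (K.indicator (fun _ => (1:ℝ))) :=
    measurable_const.indicator hK.isClosed.measurableSet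
  have hm : AEStronglyMeasurable (fun q : EuclideanSpace ℝ (Fin d) × EuclideanSpace ℝ (Fin d) =>
      K.indicator (fun _ => (1:ℝ)) q.1 * h q.2 * C₁ q.1 q.2)
      ((volume : Measure (EuclideanSpace ℝ (Fin d))).prod volume) := by
    refine AEStronglyMeasurable.mul (AEStronglyMeasurable.mul ?_ ?_) hCm
    · exact (hKm.comp measurable_fst).aestronglyMeasurable
    · exact (hh.comp continuous_snd).aestronglyMeasurable
  -- bounds
  obtain ⟨M, hM⟩ := (hK.prod hhc.isCompact).exists_bound_of_continuousOn
    (hGc.mono (Set.prod_mono hKU hhU))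
  obtain ⟨R, hR⟩ := (hK.prod hhc.isCompact).exists_bound_of_continuousOn
    (f := fun q : EuclideanSpace ℝ (Fin d) × EuclideanSpace ℝ (Fin d) => q.1 - q.2)
    (by fun_prop)
  have hhi : Integrable h := hh.integrable_of_hasCompactSupport hhc
  have hKi : Integrable (K.indicator (fun _ => (1:ℝ))) :=
    (integrable_indicator_iff hK.isClosed.measurableSet).2
      (integrableOn_const hK.measure_lt_top.ne)
  have hI1 : Integrable (fun q : EuclideanSpace ℝ (Fin d) × EuclideanSpace ℝ (Fin d) =>
      ‖h q.2‖ * (Metric.ball (0 : EuclideanSpace ℝ (Fin d)) (R+1)).indicator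
        (fun w => ‖w‖⁻¹) (q.1 - q.2))
      ((volume : Measure (EuclideanSpace ℝ (Fin d))).prod volume) :=
    Integrable.convolution_integrand (ContinuousLinearMap.mul ℝ ℝ) hhi.norm (aux_riesz d hd (R+1))
  have hI2 : Integrable (fun q : EuclideanSpace ℝ (Fin d) × EuclideanSpace ℝ (Fin d) =>
      K.indicator (fun _ => (1:ℝ)) q.1 * (M * ‖h q.2‖))
      ((volume : Measure (EuclideanSpace ℝ (Fin d))).prod volume) :=
    hKi.mul_prod (hhi.norm.const_mul M)
  refine (hI1.add hI2).mono' hm (Eventually.of_forall ?_)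
  rintro ⟨x, y⟩
  have hnn : 0 ≤ (Metric.ball (0 : EuclideanSpace ℝ (Fin d)) (R+1)).indicator
        (fun w => ‖w‖⁻¹) (x - y) := Set.indicator_nonneg (fun _ _ => by positivity) _
  by_cases hx : x ∈ K
  swap
  · simp only [Pi.add_apply, Set.indicator_of_notMem hx, zero_mul, norm_zero, add_zero]
    positivity
  by_cases hy : y ∈ tsupport h
  swap
  · simp [image_eq_zero_of_notMem_tsupport hy]
  have hMq := hM (x, y) ⟨hx, hy⟩
  have hRq := hR (x, y) ⟨hx, hy⟩
  have hb : x - y ∈ Metric.ball (0 : EuclideanSpace ℝ (Fin d)) (R+1) := by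
    simp only [mem_ball_zero_iff]; simp only at hRq; linarith
  simp only [Pi.add_apply, Set.indicator_of_mem hx, Set.indicator_of_mem hb, one_mul, norm_mul]
  have hC : ‖C₁ x y‖ ≤ ‖x - y‖⁻¹ + M := by
    rw [hC₁]
    split_ifs with hc
    · rw [hGe x hc.1 y hc.2.1]
      refine (norm_add_le _ _).trans (add_le_add ?_ hMq)
      rw [norm_neg, norm_div, dist_eq_norm, norm_pow, norm_norm]
      have hp : 0 < ‖x - y‖ := norm_pos_iff.2 (sub_ne_zero.2 hc.2.2)
      have hco : ‖x i - y i‖ ≤ ‖x - y‖ := by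
        simpa using PiLp.norm_apply_le (x - y) i
      rw [div_le_iff₀ (by positivity)]
      calc _ ≤ _ := hco
        _ = _ := by field_simp
    · have := (norm_nonneg _).trans hMq
      rw [norm_zero]; positivity
  calc ‖h y‖ * ‖C₁ x y‖ ≤ ‖h y‖ * (‖x - y‖⁻¹ + M) := by gcongr
    _ = _ := by ring

/-- **Mollified pairing with `∂₁C` converges.**
With `C(x,y) = log(1/|x−y|) + g(x,y)` for `g ∈ C²(U × U)`, `∂₁C` its partial derivative
in the first coordinate of the first variable (extended by `0` outside its domain of
definition), `φ` a mollifier supported in the annulus `B(0,1) ∖ B(0,1/2)` with `∫φ = 1`,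
and `f, h` smooth compactly supported functions on `U`: for `η ∈ (0, dist(supp f, Uᶜ)/2)`
(the distance being encoded by `D`), `J(η) = ∫∫∫ f(x) h(y) ∂₁C(u,y) φ_η(x−u) du dy dx` is
well defined, and `J(η) → ∫∫ f(x) h(y) ∂₁C(x,y) dy dx` as `η → 0⁺`. -/
theorem stmt13 (d : ℕ) (hd : 2 ≤ d)
    (U : Set (EuclideanSpace ℝ (Fin d))) (hU : IsOpen U)
    (g : EuclideanSpace ℝ (Fin d) → EuclideanSpace ℝ (Fin d) → ℝ)
    (hg : ContDiffOn ℝ 2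
      (fun p : EuclideanSpace ℝ (Fin d) × EuclideanSpace ℝ (Fin d) => g p.1 p.2) (U ×ˢ U))
    (C₁ : EuclideanSpace ℝ (Fin d) → EuclideanSpace ℝ (Fin d) → ℝ)
    (hC₁ : ∀ x y, C₁ x y = if x ∈ U ∧ y ∈ U ∧ x ≠ y then
      -((x ⟨0, by omega⟩ - y ⟨0, by omega⟩) / dist x y ^ 2)
        + fderiv ℝ (fun x' => g x' y) x (EuclideanSpace.single ⟨0, by omega⟩ 1) else 0)
    (φ : EuclideanSpace ℝ (Fin d) → ℝ) (hφ : ContDiff ℝ ∞ φ) (hφ0 : ∀ z, 0 ≤ φ z)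
    (hφsupp : tsupport φ ⊆ Metric.closedBall 0 1 \ Metric.ball 0 (1/2))
    (hφint : ∫ z, φ z = 1)
    (f h : EuclideanSpace ℝ (Fin d) → ℝ)
    (hf : ContDiff ℝ ∞ f) (hfc : HasCompactSupport f) (hfU : tsupport f ⊆ U)
    (hh : ContDiff ℝ ∞ h) (hhc : HasCompactSupport h) (hhU : tsupport h ⊆ U)
    (D : ℝ) (hD : 0 < D)
    (hDU : ∀ x ∈ tsupport f, ∀ z : EuclideanSpace ℝ (Fin d), dist z x < D → z ∈ U) :
    (∀ η ∈ Set.Ioo (0:ℝ) (D / 2),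
      Integrable (fun p : EuclideanSpace ℝ (Fin d) × EuclideanSpace ℝ (Fin d) ×
          EuclideanSpace ℝ (Fin d) =>
        f p.2.2 * h p.2.1 * C₁ p.1 p.2.1 * ((η ^ d)⁻¹ * φ (η⁻¹ • (p.2.2 - p.1)))) volume) ∧
    Tendsto (fun η : ℝ =>
        ∫ p : EuclideanSpace ℝ (Fin d) × EuclideanSpace ℝ (Fin d) ×
            EuclideanSpace ℝ (Fin d),
          f p.2.2 * h p.2.1 * C₁ p.1 p.2.1 * ((η ^ d)⁻¹ * φ (η⁻¹ • (p.2.2 - p.1))))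
      (𝓝[>] 0)
      (𝓝 (∫ q : EuclideanSpace ℝ (Fin d) × EuclideanSpace ℝ (Fin d),
        f q.1 * h q.2 * C₁ q.1 q.2)) := by
  have hKc : IsCompact (Metric.cthickening (D / 2) (tsupport f)) := hfc.isCompact.cthickening
  set K := Metric.cthickening (D / 2) (tsupport f) with hK
  have hKU : K ⊆ U := by
    intro z hz
    obtain ⟨x, hx, hzx⟩ := Metric.mem_thickening_iff.1
      (Metric.cthickening_subset_thickening' hD (half_lt_self hD) _ hz)
    exact hDU x hx z hzx
  have hΨ := aux_kernel d hd _ U hU g hg C₁ hC₁ h hh.continuous hhc hhU K hKc hKU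
  set Ψ : EuclideanSpace ℝ (Fin d) × EuclideanSpace ℝ (Fin d) → ℝ := fun q =>
    K.indicator (fun _ => (1:ℝ)) q.1 * h q.2 * C₁ q.1 q.2 with hΨdef
  have hφc : HasCompactSupport φ := by
    refine (isCompact_closedBall (0 : EuclideanSpace ℝ (Fin d)) 1).of_isClosed_subset
      (isClosed_tsupport φ) (hφsupp.trans Set.sdiff_subset)
  have hφi : Integrable φ := hφ.continuous.integrable_of_hasCompactSupport hφc
  have hfi : Integrable f := hf.continuous.integrable_of_hasCompactSupport hfc
  obtain ⟨Mf, hMf⟩ := hfc.exists_bound_of_continuous hf.continuous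
  obtain ⟨Mφ, hMφ⟩ := hφc.exists_bound_of_continuous hφ.continuous
  have hfc' := hf.continuous
  have hφc' := hφ.continuous
  -- the integrand in terms of `Ψ`
  have hpt : ∀ η ∈ Set.Ioo (0:ℝ) (D / 2), ∀ u y x : EuclideanSpace ℝ (Fin d),
      f x * h y * C₁ u y * ((η ^ d)⁻¹ * φ (η⁻¹ • (x - u)))
        = Ψ (u, y) * f x * ((η ^ d)⁻¹ * φ (η⁻¹ • (x - u))) := by
    intro η hη u y x
    by_cases hu : u ∈ K
    · simp only [hΨdef, Set.indicator_of_mem hu]; ring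
    · by_cases hx : x ∈ tsupport f
      · have hz : φ (η⁻¹ • (x - u)) = 0 := by
          by_contra hne
          have h1 := (hφsupp (subset_tsupport φ hne)).1
          rw [mem_closedBall_zero_iff, norm_smul, norm_inv, Real.norm_of_nonneg hη.1.le,
            inv_mul_le_iff₀ hη.1, mul_one] at h1
          refine hu (Metric.mem_cthickening_of_dist_le u x _ _ hx ?_)
          rw [dist_comm, dist_eq_norm]
          exact h1.trans hη.2.le
        rw [hz]; ring
      · rw [image_eq_zero_of_notMem_tsupport hx]; ring
  have hint : ∀ η : ℝ, Integrable (fun p : (EuclideanSpace ℝ (Fin d) × EuclideanSpace ℝ (Fin d)) ×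
          EuclideanSpace ℝ (Fin d) =>
        Ψ p.1 * f p.2 * ((η ^ d)⁻¹ * φ (η⁻¹ • (p.2 - p.1.1))))
        (((volume : Measure (EuclideanSpace ℝ (Fin d))).prod volume).prod volume) := by
    intro η
    refine (hΨ.mul_prod hfi).mul_bdd (c := ‖(η ^ d)⁻¹‖ * Mφ) ?_ (Eventually.of_forall ?_)
    · exact Continuous.aestronglyMeasurable (by fun_prop)
    · intro p
      rw [norm_mul]
      exact mul_le_mul_of_nonneg_left (hMφ _) (norm_nonneg _)
  have hassoc := measurePreserving_prodAssoc (volume : Measure (EuclideanSpace ℝ (Fin d)))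
    (volume : Measure (EuclideanSpace ℝ (Fin d))) (volume : Measure (EuclideanSpace ℝ (Fin d)))
  constructor
  · intro η hη
    rw [Measure.volume_eq_prod, Measure.volume_eq_prod]
    refine (hassoc.integrable_comp_emb MeasurableEquiv.prodAssoc.measurableEmbedding).1 ?_
    refine (hint η).congr (Eventually.of_forall ?_)
    rintro ⟨⟨u, y⟩, x⟩
    exact (hpt η hη u y x).symm
  -- substitution
  have hint2 : ∀ η : ℝ, Integrable (fun p : (EuclideanSpace ℝ (Fin d) × EuclideanSpace ℝ (Fin d)) ×
          EuclideanSpace ℝ (Fin d) => Ψ p.1 * φ p.2 * f (p.1.1 + η • p.2))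
        (((volume : Measure (EuclideanSpace ℝ (Fin d))).prod volume).prod volume) := by
    intro η
    refine (hΨ.mul_prod hφi).mul_bdd (c := Mf) ?_ (Eventually.of_forall fun p => hMf _)
    exact Continuous.aestronglyMeasurable (by fun_prop)
  have hJ : ∀ η ∈ Set.Ioo (0:ℝ) (D / 2),
      ∫ p : EuclideanSpace ℝ (Fin d) × EuclideanSpace ℝ (Fin d) × EuclideanSpace ℝ (Fin d),
          f p.2.2 * h p.2.1 * C₁ p.1 p.2.1 * ((η ^ d)⁻¹ * φ (η⁻¹ • (p.2.2 - p.1)))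
      = ∫ p, Ψ p.1 * φ p.2 * f (p.1.1 + η • p.2)
        ∂(((volume : Measure (EuclideanSpace ℝ (Fin d))).prod volume).prod
          (volume : Measure (EuclideanSpace ℝ (Fin d)))) := by
    intro η hη
    rw [Measure.volume_eq_prod, Measure.volume_eq_prod,
      ← hassoc.integral_comp MeasurableEquiv.prodAssoc.measurableEmbedding]
    rw [integral_prod _ (hint2 η)]
    have e1 : ∀ p : (EuclideanSpace ℝ (Fin d) × EuclideanSpace ℝ (Fin d)) ×
        EuclideanSpace ℝ (Fin d),
        (fun p : EuclideanSpace ℝ (Fin d) × EuclideanSpace ℝ (Fin d) × EuclideanSpace ℝ (Fin d) =>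
          f p.2.2 * h p.2.1 * C₁ p.1 p.2.1 * ((η ^ d)⁻¹ * φ (η⁻¹ • (p.2.2 - p.1))))
          (MeasurableEquiv.prodAssoc p)
        = Ψ p.1 * f p.2 * ((η ^ d)⁻¹ * φ (η⁻¹ • (p.2 - p.1.1))) := by
      rintro ⟨⟨u, y⟩, x⟩
      exact hpt η hη u y x
    rw [integral_congr_ae (Eventually.of_forall e1), integral_prod _ (hint η)]
    refine integral_congr_ae (Eventually.of_forall fun q => ?_)
    simp only
    have e2 := Measure.integral_comp_inv_smul_of_nonneg
      (volume : Measure (EuclideanSpace ℝ (Fin d)))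
      (fun z => Ψ q * φ z * f (q.1 + η • z)) hη.1.le
    have e3 := integral_sub_right_eq_self (μ := (volume : Measure (EuclideanSpace ℝ (Fin d))))
      (fun x => Ψ q * φ (η⁻¹ • x) * f (q.1 + η • η⁻¹ • x)) q.1
    rw [← e3, finrank_euclideanSpace_fin, smul_eq_mul] at e2
    have hηd : η ^ d ≠ 0 := pow_ne_zero _ hη.1.ne'
    rw [← mul_right_inj' hηd, ← e2, ← integral_const_mul]
    refine integral_congr_ae (Eventually.of_forall fun x => ?_)
    simp only [smul_inv_smul₀ hη.1.ne', add_sub_cancel]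
    field_simp
  have hlim : ∫ q : EuclideanSpace ℝ (Fin d) × EuclideanSpace ℝ (Fin d),
        f q.1 * h q.2 * C₁ q.1 q.2
      = ∫ p, Ψ p.1 * φ p.2 * f p.1.1
        ∂(((volume : Measure (EuclideanSpace ℝ (Fin d))).prod volume).prod
          (volume : Measure (EuclideanSpace ℝ (Fin d)))) := by
    have e1 : (fun p : (EuclideanSpace ℝ (Fin d) × EuclideanSpace ℝ (Fin d)) ×
        EuclideanSpace ℝ (Fin d) => Ψ p.1 * φ p.2 * f p.1.1)
        = fun p => (Ψ p.1 * f p.1.1) * φ p.2 := by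
      funext p; ring
    rw [e1, integral_prod_mul (fun q => Ψ q * f q.1) φ, hφint, mul_one, Measure.volume_eq_prod]
    refine integral_congr_ae (Eventually.of_forall fun q => ?_)
    simp only
    by_cases hq : q.1 ∈ tsupport f
    · have : q.1 ∈ K := Metric.self_subset_cthickening _ hq
      simp only [hΨdef, Set.indicator_of_mem this]; ring
    · rw [image_eq_zero_of_notMem_tsupport hq]; ring
  rw [hlim]
  have hev : ∀ᶠ η : ℝ in 𝓝[>] 0, η ∈ Set.Ioo (0:ℝ) (D / 2) := Ioo_mem_nhdsGT (by positivity)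
  refine Tendsto.congr' (hev.mono fun η hη => (hJ η hη).symm) ?_
  refine tendsto_integral_filter_of_dominated_convergence
    (fun p => ‖Ψ p.1 * φ p.2‖ * Mf) (Eventually.of_forall fun η => (hint2 η).1)
    (Eventually.of_forall fun η => Eventually.of_forall fun p => ?_)
    ((hΨ.mul_prod hφi).norm.mul_const Mf) (Eventually.of_forall fun p => ?_)
  · rw [norm_mul]
    exact mul_le_mul_of_nonneg_left (hMf _) (norm_nonneg _)
  · refine Tendsto.const_mul _ ?_
    have hc : Continuous fun η : ℝ => f (p.1.1 + η • p.2) := by fun_prop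
    have := (hc.tendsto 0).mono_left (nhdsWithin_le_nhds (s := Set.Ioi 0))
    simpa using this
end
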